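/- For n = 3 and any fixed valences a, b, c, d ∈ Z≥0 and any fixed clockwise order of the four marked points, there are at most 2 distinct arc diagrams with these valences and border thickness 0 (i.e., with no arcs between at least one adjacent pair of points). -/

import Mathlib

namespace CactusPaper

/-- The indexing set of the generators `s_{p,q}`, `1 ≤ p < q ≤ n`, of the cactus group. -/
abbrev GenIdx (n : ℕ) : Type := {pq : ℕ × ℕ // 1 ≤ pq.1 ∧ pq.1 < pq.2 ∧ pq.2 ≤ n}

/-- The defining relations of the cactus group `J_n`:
`s_{p,q}² = e`;  `s_{p,q} s_{p',q'} = s_{p',q'} s_{p,q}` whenever the intervals `[p,q]` and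
`[p',q']` are disjoint;  `s_{p,q} s_{p',q'} s_{p,q} = s_{p+q-q', p+q-p'}` whenever
`p ≤ p' < q' ≤ q`. -/
def cactusRels (n : ℕ) : Set (FreeGroup (GenIdx n)) :=
  {w | (∃ s : GenIdx n, w = FreeGroup.of s * FreeGroup.of s) ∨
    (∃ s t : GenIdx n, (s.1.2 < t.1.1 ∨ t.1.2 < s.1.1) ∧
      w = FreeGroup.of s * FreeGroup.of t * (FreeGroup.of s)⁻¹ * (FreeGroup.of t)⁻¹) ∨
    (∃ s t u : GenIdx n, s.1.1 ≤ t.1.1 ∧ t.1.2 ≤ s.1.2 ∧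
      u.1.1 = s.1.1 + s.1.2 - t.1.2 ∧ u.1.2 = s.1.1 + s.1.2 - t.1.1 ∧
      w = FreeGroup.of s * FreeGroup.of t * FreeGroup.of s * (FreeGroup.of u)⁻¹)}

/-- The cactus group `J_n`, presented by the generators `s_{p,q}` and the cactus relations. -/
abbrev CactusGroup (n : ℕ) : Type := PresentedGroup (cactusRels n)

/-- The generator `s_{p,q}` of the cactus group `J_n`. -/
def gen (n : ℕ) (s : GenIdx n) : CactusGroup n := PresentedGroup.of s

/-- The generator `s_{p,q}` of `J_n`, with the constraints on `p, q` given separately. -/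
def genPQ (n p q : ℕ) (h1 : 1 ≤ p) (h2 : p < q) (h3 : q ≤ n) : CactusGroup n :=
  gen n ⟨(p, q), h1, h2, h3⟩

/-- Raw data of an arc diagram on the disc with `n+1` marked boundary points:
position `0` carries `z_∞` and positions `1, …, n` carry the finite points, in clockwise
order starting from `z_∞`;  `lbl k` is the index `i` of the label `z_i` sitting at
position `k`, and `mult i j` is the number of (parallel, non-crossing) arcs joining the
marked points at positions `i` and `j`.  (An isotopy class of a system of non-crossing
arcs is faithfully recorded by these multiplicities.) -/
structure PreDiagram (n : ℕ) where
  lbl : ℕ → ℕ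
  mult : ℕ → ℕ → ℕ

/-- The valence (total number of arc ends) at position `k`. -/
def valence {n : ℕ} (D : PreDiagram n) (k : ℕ) : ℕ :=
  ∑ j ∈ Finset.range (n + 1), D.mult k j

/-- `D` is an arc diagram in `X(l 1, …, l n, linf)`: the labels of positions `1, …, n` are
a bijection of `{1, …, n}` (normalized to `0` elsewhere), the multiplicity matrix is
symmetric, loopless and supported on positions `≤ n`, the arcs are pairwise non-crossing,
the point `z_∞` has valence `linf`, and the point `z_i` has valence `l i`. -/
def IsDiagram {n : ℕ} (l : ℕ → ℕ) (linf : ℕ) (D : PreDiagram n) : Prop :=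
  Set.BijOn D.lbl (Set.Icc 1 n) (Set.Icc 1 n) ∧
  (∀ k, k ∉ Set.Icc 1 n → D.lbl k = 0) ∧
  (∀ i j, D.mult i j = D.mult j i) ∧
  (∀ i, D.mult i i = 0) ∧
  (∀ i j, n < i ∨ n < j → D.mult i j = 0) ∧
  (∀ a b c d, a < b → b < c → c < d → d ≤ n → D.mult a c = 0 ∨ D.mult b d = 0) ∧
  valence D 0 = linf ∧
  (∀ k, 1 ≤ k → k ≤ n → valence D k = l (D.lbl k))

/-- The set `X(l 1, …, l n, linf)` of arc diagrams. -/
abbrev ADiagram (n : ℕ) (l : ℕ → ℕ) (linf : ℕ) : Type :=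
  {D : PreDiagram n // IsDiagram l linf D}

/-- The involution of positions reversing the interval `[p,q]`. -/
def sigmaRev (p q k : ℕ) : ℕ := if p ≤ k ∧ k ≤ q then p + q - k else k

/-- The number of arcs at position `a` crossing the shear line of `s_{p,q}`, i.e. joining
`a` to a position outside `[p,q]`. -/
def crossDeg {n : ℕ} (D : PreDiagram n) (p q a : ℕ) : ℕ :=
  ∑ j ∈ (Finset.range (n + 1)).filter (fun j => j < p ∨ q < j), D.mult a j

/-- Cumulative count, along the shear line of `s_{p,q}`, of the crossing arcs of the *new*
(reversed) diagram emanating from positions `p, …, a` of the active region (the point at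
position `b` of the new diagram is the point at position `p+q-b` of the old one). -/
def inCum {n : ℕ} (D : PreDiagram n) (p q a : ℕ) : ℕ :=
  ∑ b ∈ Finset.Icc p a, crossDeg D p q (p + q - b)

/-- The positions outside `[p,q]` in their order along the shear line, starting from the
end of the shear line lying between positions `p-1` and `p`:
`p-1, p-2, …, 1, 0, n, n-1, …, q+1`. -/
def outRank (n p j : ℕ) : ℕ := if j < p then p - 1 - j else p + (n - j)

/-- Cumulative count, along the shear line, of the crossing arc ends outside the active
region, up to (and including) those attached at position `j`. -/
def outCum {n : ℕ} (D : PreDiagram n) (p q j : ℕ) : ℕ :=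
  ∑ j' ∈ (Finset.range (n + 1)).filter
      (fun j' => (j' < p ∨ q < j') ∧ outRank n p j' ≤ outRank n p j),
    crossDeg D p q j'

/-- The number of arcs of the new diagram joining a position `a ∈ [p,q]` to a position
`j ∉ [p,q]`: the cut arcs are reconnected matching up, in order, the crossing arc ends on
the two sides of the shear line (this being the unique non-crossing reconnection), so this
number is the overlap of the interval of shear-line indices belonging to `a` with the one
belonging to `j`. -/
def crossMult {n : ℕ} (D : PreDiagram n) (p q a j : ℕ) : ℕ :=
  min (inCum D p q a) (outCum D p q j) -
    max (inCum D p q a - crossDeg D p q (p + q - a)) (outCum D p q j - crossDeg D p q j)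

/-- The action of the generator `s_{p,q}` on arc-diagram data: the marked points at the
positions in `[p,q]` are reversed (together with their labels), the arcs inside the active
region are reflected along with them, the arcs outside are kept, and the arcs crossing the
shear line are reconnected in the unique non-crossing fashion. -/
def genAct {n : ℕ} (p q : ℕ) (D : PreDiagram n) : PreDiagram n where
  lbl := fun k => D.lbl (sigmaRev p q k)
  mult := fun i j =>
    if n < i ∨ n < j then 0
    else if (p ≤ i ∧ i ≤ q) ∧ (p ≤ j ∧ j ≤ q) then D.mult (sigmaRev p q i) (sigmaRev p q j)
    else if p ≤ i ∧ i ≤ q then crossMult D p q i j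
    else if p ≤ j ∧ j ≤ q then crossMult D p q j i
    else D.mult i j

/-- `A` is *the* action of the cactus group `J_n` on `X(l 1, …, l n, linf)`: a group
homomorphism `J_n →* Perm(X)` sending each generator `s_{p,q}` to the
reversal-and-reconnection operation `genAct p q`. -/
def IsCactusAction {n : ℕ} (l : ℕ → ℕ) (linf : ℕ)
    (A : CactusGroup n →* Equiv.Perm (ADiagram n l linf)) : Prop :=
  ∀ (s : GenIdx n) (x : ADiagram n l linf),
    ((A (gen n s)) x).1 = genAct s.1.1 s.1.2 x.1

/-- The border thickness of an arc diagram: the minimal number of arcs joining a pair of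
adjacent marked points (positions `k` and `k+1 mod (n+1)`). -/
noncomputable def borderThickness {n : ℕ} (D : PreDiagram n) : ℕ :=
  sInf {m : ℕ | ∃ k ≤ n, m = D.mult k ((k + 1) % (n + 1))}

/-- The greatest common divisor of all the arc multiplicities of the diagram. -/
def multGcd {n : ℕ} (D : PreDiagram n) : ℕ :=
  Finset.gcd (Finset.range (n + 1) ×ˢ Finset.range (n + 1)) (fun ij => D.mult ij.1 ij.2)

/-- Clockwise cyclic distance from position `k` to position `j` among the `n+1`
boundary positions. -/
def cdist (n k j : ℕ) : ℕ := (j + (n + 1) - k) % (n + 1)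

/-- The number of arc ends at `k` lying strictly clockwise of the bundle of parallel arcs
joining `k` to `j` (the arcs from `k` to clockwise-nearer targets attach to `k` on the
clockwise side). -/
def cumBefore {n : ℕ} (D : PreDiagram n) (k j : ℕ) : ℕ :=
  ∑ j' ∈ (Finset.range (n + 1)).filter (fun j' => cdist n k j' < cdist n k j), D.mult k j'

/-- Arc ends: at position `k` the `valence D k` arc ends are numbered `0, 1, …` in
clockwise order.  `ArcRel D (k, t) (j, s)` holds exactly when some arc of the diagram has
its two ends at `(k, t)` and `(j, s)`: the `r`-th parallel arc (counted from the outermost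
one) of the bundle joining `k` and `j` attaches at its two endpoints in opposite relative
orders. -/
def ArcRel {n : ℕ} (D : PreDiagram n) (e f : ℕ × ℕ) : Prop :=
  ∃ r < D.mult e.1 f.1,
    e.2 = valence D e.1 - cumBefore D e.1 f.1 - 1 - r ∧
    f.2 = valence D f.1 - cumBefore D f.1 e.1 - D.mult e.1 f.1 + r

/-- The right-hand-rule pairing: at each marked point the consecutive arc ends `2r` and
`2r + 1` (in clockwise order) are joined within one loop of the decomposition. -/
def RhrRel {n : ℕ} (D : PreDiagram n) (e f : ℕ × ℕ) : Prop :=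
  e.1 = f.1 ∧ ∃ r, e.2 = 2 * r ∧ f.2 = 2 * r + 1

/-- The arc ends of an arc diagram. -/
abbrev Endpoint {n : ℕ} (D : PreDiagram n) : Type :=
  {e : ℕ × ℕ // e.1 ≤ n ∧ e.2 < valence D e.1}

/-- The number of components of an arc diagram all of whose valences are even: the number
of closed non-overlapping loops into which the arcs decompose under the right-hand rule.
Formally, it is the number of equivalence classes of arc ends under the equivalence
relation generated by "being the two ends of one arc" (`ArcRel`) together with the
right-hand-rule pairing at each marked point (`RhrRel`). -/
noncomputable def numComponents {n : ℕ} (D : PreDiagram n) : ℕ :=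
  Nat.card (Quot (fun e f : Endpoint D => ArcRel D e.1 f.1 ∨ RhrRel D e.1 f.1))

/-- Extensionality for arc diagrams with four marked points. -/
theorem diag3_ext {l : ℕ → ℕ} {linf : ℕ} {x y : PreDiagram 3}
    (hx : IsDiagram l linf x) (hy : IsDiagram l linf y) (hl : x.lbl = y.lbl)
    (h01 : x.mult 0 1 = y.mult 0 1) (h12 : x.mult 1 2 = y.mult 1 2)
    (h23 : x.mult 2 3 = y.mult 2 3) (h30 : x.mult 3 0 = y.mult 3 0)
    (h02 : x.mult 0 2 = y.mult 0 2) (h13 : x.mult 1 3 = y.mult 1 3) : x = y := by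
  obtain ⟨-, -, sx, dx, ox, -, -, -⟩ := hx
  obtain ⟨-, -, sy, dy, oy, -, -, -⟩ := hy
  obtain ⟨lx, mx⟩ := x
  obtain ⟨ly, my⟩ := y
  simp only at *
  subst hl
  congr 1
  funext i j
  by_cases h : 3 < i ∨ 3 < j
  · rw [ox i j h, oy i j h]
  · have hi : i ≤ 3 := by omega
    have hj : j ≤ 3 := by omega
    have a1 := sx 1 0
    have a2 := sx 2 0
    have a3 := sx 3 0
    have a4 := sx 2 1
    have a5 := sx 3 1
    have a6 := sx 3 2
    have b1 := sy 1 0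
    have b2 := sy 2 0
    have b3 := sy 3 0
    have b4 := sy 2 1
    have b5 := sy 3 1
    have b6 := sy 3 2
    interval_cases i <;> interval_cases j <;> first | omega | rw [dx, dy]

/-- The linear constraints satisfied by a border-thickness-zero diagram. -/
theorem diag3_facts {l : ℕ → ℕ} {linf : ℕ} {L : ℕ → ℕ} {x : PreDiagram 3}
    (hx : IsDiagram l linf x ∧ x.lbl = L ∧ borderThickness x = 0) :
    (x.mult 0 1 + x.mult 3 0 + x.mult 0 2 = linf ∧
     x.mult 0 1 + x.mult 1 2 + x.mult 1 3 = l (L 1) ∧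
     x.mult 1 2 + x.mult 2 3 + x.mult 0 2 = l (L 2) ∧
     x.mult 2 3 + x.mult 3 0 + x.mult 1 3 = l (L 3)) ∧
    (x.mult 0 2 = 0 ∨ x.mult 1 3 = 0) ∧
    ((x.mult 0 1 = 0 ∨ x.mult 2 3 = 0) ∨ (x.mult 1 2 = 0 ∨ x.mult 3 0 = 0)) := by
  obtain ⟨⟨-, -, s, d, -, c, v0, v⟩, rfl, hb⟩ := hx
  have v1 := v 1 (by norm_num) (by norm_num)
  have v2 := v 2 (by norm_num) (by norm_num)
  have v3 := v 3 (by norm_num) (by norm_num)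
  simp only [valence, Finset.sum_range_succ, Finset.sum_range_zero, d] at v0 v1 v2 v3
  have a1 := s 1 0
  have a2 := s 2 0
  have a3 := s 3 0
  have a4 := s 2 1
  have a5 := s 3 1
  have a6 := s 3 2
  refine ⟨by omega, c 0 1 2 3 (by norm_num) (by norm_num) (by norm_num) (by norm_num), ?_⟩
  have hm : borderThickness x ∈ {m : ℕ | ∃ k ≤ 3, m = x.mult k ((k + 1) % (3 + 1))} :=
    Nat.sInf_mem ⟨_, 0, by norm_num, rfl⟩
  obtain ⟨k, hk, e⟩ := hm
  rw [hb] at e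
  interval_cases k <;> norm_num at e <;> omega

/-- The two diagonal multiplicities are determined by the valences. -/
theorem diag_aux {A B C D p q r s e f pp qq rr ss ee ff : ℕ}
    (h : p + s + e = A ∧ p + q + f = B ∧ q + r + e = C ∧ r + s + f = D)
    (hh : pp + ss + ee = A ∧ pp + qq + ff = B ∧ qq + rr + ee = C ∧ rr + ss + ff = D)
    (c : e = 0 ∨ f = 0) (cc : ee = 0 ∨ ff = 0) : e = ee ∧ f = ff := by
  have k : e + ff = ee + f := by omega
  rcases c with c | c <;> rcases cc with cc | cc <;> omega

/-- Two diagrams missing a side in the same opposite pair have equal sides. -/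
theorem side_aux {A B C D p q r s e f pp qq rr ss : ℕ}
    (h : p + s + e = A ∧ p + q + f = B ∧ q + r + e = C ∧ r + s + f = D)
    (hh : pp + ss + e = A ∧ pp + qq + f = B ∧ qq + rr + e = C ∧ rr + ss + f = D)
    (b : ((p = 0 ∨ r = 0) ∧ (pp = 0 ∨ rr = 0)) ∨ ((q = 0 ∨ s = 0) ∧ (qq = 0 ∨ ss = 0))) :
    p = pp ∧ q = qq ∧ r = rr ∧ s = ss := by
  have k1 : p + s = pp + ss := by omega
  have k2 : p + q = pp + qq := by omega
  have k3 : q + r = qq + rr := by omega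
  clear h hh
  rcases b with ⟨b | b, bb | bb⟩ | ⟨b | b, bb | bb⟩ <;> omega

/-- Two diagrams missing a side in the same opposite pair coincide. -/
theorem diag3_eq {l : ℕ → ℕ} {linf : ℕ} {L : ℕ → ℕ} {x y : PreDiagram 3}
    (hx : IsDiagram l linf x ∧ x.lbl = L ∧ borderThickness x = 0)
    (hy : IsDiagram l linf y ∧ y.lbl = L ∧ borderThickness y = 0)
    (b : ((x.mult 0 1 = 0 ∨ x.mult 2 3 = 0) ∧ (y.mult 0 1 = 0 ∨ y.mult 2 3 = 0)) ∨
      ((x.mult 1 2 = 0 ∨ x.mult 3 0 = 0) ∧ (y.mult 1 2 = 0 ∨ y.mult 3 0 = 0))) : x = y := by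
  obtain ⟨fx, cx, -⟩ := diag3_facts hx
  obtain ⟨fy, cy, -⟩ := diag3_facts hy
  obtain ⟨he, hf⟩ := diag_aux fx fy cx cy
  rw [← he, ← hf] at fy
  obtain ⟨h1, h2, h3, h4⟩ := side_aux fx fy b
  exact diag3_ext hx.1 hy.1 (hx.2.1.trans hy.2.1.symm) h1 h2 h3 h4 he hf

/-- For `n = 3`, any fixed valences (prescribed by `l`, `linf`) and any
fixed clockwise order of the four marked points (prescribed labeling `L`), there are at
most `2` distinct arc diagrams with these valences and border thickness `0` (i.e. with no
arcs between at least one adjacent pair of marked points). -/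
theorem statement_7 (l : ℕ → ℕ) (linf : ℕ) (L : ℕ → ℕ) (x y z : PreDiagram 3)
    (hx : IsDiagram l linf x ∧ x.lbl = L ∧ borderThickness x = 0)
    (hy : IsDiagram l linf y ∧ y.lbl = L ∧ borderThickness y = 0)
    (hz : IsDiagram l linf z ∧ z.lbl = L ∧ borderThickness z = 0) :
    x = y ∨ x = z ∨ y = z := by
  have exy := diag3_eq hx hy
  have exz := diag3_eq hx hz
  have eyz := diag3_eq hy hz
  have bx := (diag3_facts hx).2.2
  have bY := (diag3_facts hy).2.2
  have bz := (diag3_facts hz).2.2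
  rcases bx with bx | bx <;> rcases bY with bY | bY <;> rcases bz with bz | bz
  · exact Or.inl (exy (Or.inl ⟨bx, bY⟩))
  · exact Or.inl (exy (Or.inl ⟨bx, bY⟩))
  · exact Or.inr (Or.inl (exz (Or.inl ⟨bx, bz⟩)))
  · exact Or.inr (Or.inr (eyz (Or.inr ⟨bY, bz⟩)))
  · exact Or.inr (Or.inr (eyz (Or.inl ⟨bY, bz⟩)))
  · exact Or.inr (Or.inl (exz (Or.inr ⟨bx, bz⟩)))
  · exact Or.inl (exy (Or.inr ⟨bx, bY⟩))
  · exact Or.inl (exy (Or.inr ⟨bx, bY⟩))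

end CactusPaper
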